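/- There is no Graeco-Latin square of order 6: there do not exist functions f, g : Fin 6 × Fin 6 → Fin 6 such that f and g are each Latin squares (for every fixed row index i the map j ↦ f(i,j) is bijective and for every fixed column index j the map i ↦ f(i,j) is bijective, and likewise for g) and the combined map (i,j) ↦ (f(i,j), g(i,j)) is a bijection from Fin 6 × Fin 6 to Fin 6 × Fin 6. -/

import Mathlib

/-- The cell-`(i, j)` code: a column bit, a symbol bit and a cell bit. -/
def cellCode (i j s : Nat) : Nat :=
  Nat.lor (Nat.lor (2 ^ j) (2 ^ (6 + s))) (2 ^ (12 + (6 * i + j)))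

def rowItems (i : Nat) (r : List Nat) : List Nat :=
  List.zipWith (fun j s => cellCode i j s) [0, 1, 2, 3, 4, 5] r

def extOne (M : Nat) : List Nat → List Nat → List Nat
  | [], acc => acc
  | b :: it, acc =>
    cond (Nat.beq (Nat.land M b) 0) (Nat.lor M b :: extOne M it acc) (extOne M it acc)

def extAll (it : List Nat) : List Nat → List Nat
  | [] => []
  | M :: L => extOne M it (extAll it L)

def cellMask : Nat := 281474976706560

/-- No way to choose pairwise disjoint transversals from the given lists. -/
def noCover : List (List Nat) → Nat → Bool
  | [], _ => false
  | L :: Ls, used => L.all fun T =>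
      cond (Nat.beq (Nat.land used T) 0) (noCover Ls (Nat.lor used (Nat.land T cellMask))) true

def rowDisj : List Nat → List Nat → Bool
  | a :: l, b :: m => cond (Nat.beq a b) false (rowDisj l m)
  | _, _ => true

def allRows : List (List Nat) := List.permutations' [0, 1, 2, 3, 4, 5]

def search : Nat → Nat → List (List Nat) → List (List Nat) → Bool
  | 0, _, _, parts => noCover parts 0
  | k + 1, i, cands, parts => cands.all fun r =>
      cond (Nat.beq (r.headD 0) i)
        (search k (i + 1) (cands.filter (rowDisj r)) (parts.map (extAll (rowItems i r)))) true

def rowZero : List Nat := [0, 1, 2, 3, 4, 5]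

def startParts : List (List Nat) := (rowItems 0 rowZero).map fun b => [b]

def checkRow (c : List Nat) : Bool :=
  search 4 2 ((allRows.filter (rowDisj rowZero)).filter (rowDisj c))
    (startParts.map (extAll (rowItems 1 c)))

def canonRows : List (List Nat) :=
  [[1, 2, 3, 4, 5, 0], [1, 2, 3, 0, 5, 4], [1, 2, 0, 4, 5, 3], [1, 0, 3, 2, 5, 4]]

/-- `u` is injective with values below 6, and `p ∘ u = u ∘ c`. -/
def conjRow (p c u : List Nat) : Bool :=
  rowZero.all fun j =>
    Nat.beq (p.getD (u.getD j 0) 0) (u.getD (c.getD j 0) 0) &&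
      (Nat.ble (u.getD j 0) 5 &&
        rowZero.all fun k => Nat.beq j k || !(Nat.beq (u.getD j 0) (u.getD k 0)))

def orbit (p : List Nat) : Nat → Nat → List Nat
  | 0, _ => []
  | n + 1, x => x :: orbit p n (p.getD x 0)

def conjTest (p : List Nat) : Bool :=
  conjRow p [1, 2, 3, 4, 5, 0] (orbit p 6 0) ||
  (rowZero.any fun x => rowZero.any fun y =>
    conjRow p [1, 2, 3, 0, 5, 4] (orbit p 4 x ++ orbit p 2 y)) ||
  (rowZero.any fun y => conjRow p [1, 2, 0, 4, 5, 3] (orbit p 3 0 ++ orbit p 3 y)) ||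
  (rowZero.any fun y => rowZero.any fun z =>
    conjRow p [1, 0, 3, 2, 5, 4] (orbit p 2 0 ++ (orbit p 2 y ++ orbit p 2 z)))

def conjCheck : Bool :=
  (allRows.filter (rowDisj rowZero)).all conjTest

def rowOf (p : Fin 6 → Fin 6) : List Nat := List.ofFn fun j => (p j).val

/-- The column pattern as a function. -/
def canonFun (c : List ℕ) (j : Fin 6) : Fin 6 := Fin.ofNat 6 (c.getD j.val 0)

theorem mem_allRows (p : Fin 6 → Fin 6) (hp : Function.Injective p) : rowOf p ∈ allRows := by
  unfold allRows
  rw [List.mem_permutations']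
  have h1 : (rowOf p).Nodup := by
    unfold rowOf
    rw [List.nodup_ofFn]
    intro a b h
    exact hp (Fin.ext h)
  apply List.perm_of_nodup_nodup_toFinset_eq h1 (by decide)
  have hs : Function.Surjective p := Finite.surjective_of_injective hp
  ext x
  simp only [List.mem_toFinset, rowOf, List.mem_ofFn]
  constructor
  · rintro ⟨j, rfl⟩
    have := (p j).isLt
    generalize (p j).val = v at *
    interval_cases v <;> simp
  · intro h
    have hx : x < 6 := by
      simp at h
      omega
    obtain ⟨j, hj⟩ := hs ⟨x, hx⟩
    exact ⟨j, by rw [hj]⟩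

theorem rowDisj_rowOf (p q : Fin 6 → Fin 6) (h : ∀ j, p j ≠ q j) :
    rowDisj (rowOf p) (rowOf q) = true := by
  have h' : ∀ j, Nat.beq (p j).val (q j).val = false := by
    intro j
    rw [Bool.eq_false_iff]
    exact fun e => h j (Fin.ext (Nat.eq_of_beq_eq_true e))
  simp only [rowOf, List.ofFn_succ, List.ofFn_zero, rowDisj, h', cond_false]

theorem getD_rowOf (p : Fin 6 → Fin 6) (v : ℕ) (hv : v < 6) :
    (rowOf p).getD v 0 = (p ⟨v, hv⟩).val := by
  interval_cases v <;> rfl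

theorem canonRows_lt : ∀ c ∈ canonRows, ∀ j : Fin 6, c.getD j.val 0 < 6 := by decide

theorem canonRows_head : ∀ c ∈ canonRows, canonFun c 0 = 1 := by decide

theorem mem_extOne_acc (M x : ℕ) (it acc : List ℕ) (h : x ∈ acc) : x ∈ extOne M it acc := by
  induction it with
  | nil => exact h
  | cons b it ih =>
    unfold extOne
    cases Nat.beq (Nat.land M b) 0
    · exact ih
    · exact List.mem_cons_of_mem _ ih

theorem mem_extOne (M b : ℕ) (it acc : List ℕ) (hb : b ∈ it) (h : Nat.land M b = 0) :
    Nat.lor M b ∈ extOne M it acc := by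
  induction it with
  | nil => simp at hb
  | cons a it ih =>
    unfold extOne
    rcases List.mem_cons.1 hb with rfl | hb
    · rw [h]
      exact List.mem_cons_self
    · cases Nat.beq (Nat.land M a) 0
      · exact ih hb
      · exact List.mem_cons_of_mem _ (ih hb)

theorem mem_extAll (M b : ℕ) (it L : List ℕ) (hM : M ∈ L) (hb : b ∈ it)
    (h : Nat.land M b = 0) : Nat.lor M b ∈ extAll it L := by
  induction L with
  | nil => simp at hM
  | cons a L ih =>
    unfold extAll
    rcases List.mem_cons.1 hM with rfl | hM
    · exact mem_extOne M b it _ hb h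
    · exact mem_extOne_acc _ _ _ _ (ih hM)

theorem mem_rowItems (i : ℕ) (p : Fin 6 → Fin 6) (j : Fin 6) :
    cellCode i j.val (p j).val ∈ rowItems i (rowOf p) := by
  fin_cases j <;> simp [rowItems, rowOf, List.ofFn_succ]

theorem cellCode_disj (i j s i' j' s' : ℕ) (hj : j < 6) (hs : s < 6) (hj' : j' < 6)
    (hs' : s' < 6) (h1 : j ≠ j') (h2 : s ≠ s') :
    Nat.land (cellCode i j s) (cellCode i' j' s') = 0 := by
  change (2 ^ j ||| 2 ^ (6 + s) ||| 2 ^ (12 + (6 * i + j))) &&&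
    (2 ^ j' ||| 2 ^ (6 + s') ||| 2 ^ (12 + (6 * i' + j'))) = 0
  apply Nat.eq_of_testBit_eq
  intro n
  simp only [Nat.testBit_and, Nat.testBit_or, Nat.testBit_two_pow, Nat.zero_testBit]
  by_contra hne
  simp at hne
  omega

theorem cellCode_mask (i j s : ℕ) (hi : i < 6) (hj : j < 6) (hs : s < 6) :
    Nat.land (cellCode i j s) cellMask = 2 ^ (12 + (6 * i + j)) := by
  interval_cases i <;> interval_cases j <;> interval_cases s <;> decide

theorem cell_disj (i j i' j' s' : ℕ) (hj : j < 6) (hj' : j' < 6)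
    (hs' : s' < 6) (h : ¬ (i = i' ∧ j = j')) :
    Nat.land (2 ^ (12 + (6 * i + j))) (cellCode i' j' s') = 0 := by
  change 2 ^ (12 + (6 * i + j)) &&&
    (2 ^ j' ||| 2 ^ (6 + s') ||| 2 ^ (12 + (6 * i' + j'))) = 0
  apply Nat.eq_of_testBit_eq
  intro n
  simp only [Nat.testBit_and, Nat.testBit_or, Nat.testBit_two_pow, Nat.zero_testBit]
  by_contra hne
  simp at hne
  omega

theorem lor_land (a b c : ℕ) (h1 : Nat.land a c = 0) (h2 : Nat.land b c = 0) :
    Nat.land (Nat.lor a b) c = 0 := by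
  change (a ||| b) &&& c = 0
  rw [Nat.and_or_distrib_right]
  change Nat.lor (Nat.land a c) (Nat.land b c) = 0
  rw [h1, h2]
  rfl

theorem land_lor (a b c : ℕ) (h1 : Nat.land c a = 0) (h2 : Nat.land c b = 0) :
    Nat.land c (Nat.lor a b) = 0 := by
  change c &&& (a ||| b) = 0
  rw [Nat.and_or_distrib_left]
  change Nat.lor (Nat.land c a) (Nat.land c b) = 0
  rw [h1, h2]
  rfl

theorem noCover_sound (T : Fin 6 → ℕ)
    (hT : ∀ k k', k ≠ k' → Nat.land (Nat.land (T k) cellMask) (T k') = 0) :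
    ∀ (Ls : List (List ℕ)) (ks : List (Fin 6)) (used : ℕ),
      List.Forall₂ (fun k L => T k ∈ L) ks Ls → ks.Nodup →
      (∀ k ∈ ks, Nat.land used (T k) = 0) → noCover Ls used = true → False := by
  intro Ls
  induction Ls with
  | nil => intro ks used _ _ _ h; simp [noCover] at h
  | cons L Ls ih =>
    intro ks used hF hn hu h
    cases hF with
    | @cons k _ ks _ hk hF =>
      unfold noCover at h
      rw [List.all_eq_true] at h
      have h := h _ hk
      rw [hu k List.mem_cons_self] at h
      rw [List.nodup_cons] at hn
      refine ih ks _ hF hn.2 ?_ h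
      intro k' hk'
      apply lor_land
      · exact hu k' (List.mem_cons_of_mem _ hk')
      · apply hT
        rintro rfl
        exact hn.1 hk'

/-- The code of the first `n` cells of the `k`-th transversal. -/
def partCode (f t : Fin 6 → Fin 6 → Fin 6) (k : Fin 6) : ℕ → ℕ
  | 0 => 0
  | n + 1 => Nat.lor (partCode f t k n)
      (cellCode n (t k (Fin.ofNat 6 n)).val (f (Fin.ofNat 6 n) (t k (Fin.ofNat 6 n))).val)

theorem search_sound (f t : Fin 6 → Fin 6 → Fin 6)
    (hfr : ∀ i i' j, i ≠ i' → f i j ≠ f i' j)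
    (hc0 : ∀ i, f i 0 = i)
    (ht : ∀ k i i', i ≠ i' → t k i ≠ t k i')
    (hft : ∀ k i i', i ≠ i' → f i (t k i) ≠ f i' (t k i'))
    (htk : ∀ k k' i, k ≠ k' → t k i ≠ t k' i) :
    ∀ (m n : ℕ) (cands parts : List (List ℕ)), m + n = 6 →
      (∀ i : Fin 6, n ≤ i.val → rowOf (f i) ∈ cands) →
      List.Forall₂ (fun k L => partCode f t k n ∈ L) (List.finRange 6) parts →
      search m n cands parts = true → False := by
  have hof : ∀ n < 6, (Fin.ofNat 6 n).val = n := fun n hn => Nat.mod_eq_of_lt hn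
  have hne : ∀ a b : ℕ, a < 6 → b < 6 → a ≠ b → Fin.ofNat 6 a ≠ Fin.ofNat 6 b := by
    intro a b ha hb hab h
    have := congrArg Fin.val h
    rw [hof a ha, hof b hb] at this
    exact hab this
  intro m
  induction m with
  | zero =>
    intro n cands parts hn _ hF h
    have hn : n = 6 := by omega
    subst hn
    unfold search at h
    refine noCover_sound (fun k => partCode f t k 6) ?_ parts _ 0 hF (List.nodup_finRange 6) ?_ h
    · intro k k' hk
      have key : ∀ a ≤ 6, ∀ b ≤ 6,
          Nat.land (Nat.land (partCode f t k a) cellMask) (partCode f t k' b) = 0 := by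
        intro a
        induction a with
        | zero => intro _ b _; simp [partCode, Nat.land]
        | succ a iha =>
          intro ha b hb
          have hd : Nat.land (partCode f t k (a + 1)) cellMask =
              Nat.lor (Nat.land (partCode f t k a) cellMask)
                (2 ^ (12 + (6 * a + (t k (Fin.ofNat 6 a)).val))) := by
            rw [← cellCode_mask a _ (f (Fin.ofNat 6 a) (t k (Fin.ofNat 6 a))).val
              (by omega) (Fin.isLt _) (Fin.isLt _)]
            exact Nat.and_or_distrib_right _ _ _
          rw [hd]
          apply lor_land
          · exact iha (by omega) b hb
          · clear hd iha
            induction b with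
            | zero => exact Nat.and_zero _
            | succ b ihb =>
              apply land_lor
              · exact ihb (by omega)
              · apply cell_disj _ _ _ _ _ (Fin.isLt _) (Fin.isLt _) (Fin.isLt _)
                rintro ⟨rfl, h⟩
                exact htk k k' _ hk (Fin.ext h)
      exact key 6 le_rfl 6 le_rfl
    · intro k _
      exact Nat.zero_and _
  | succ m ih =>
    intro n cands parts hn hc hF h
    have hn6 : n < 6 := by omega
    unfold search at h
    rw [List.all_eq_true] at h
    have h := h _ (hc (Fin.ofNat 6 n) (by rw [hof n hn6]))
    have hh : (rowOf (f (Fin.ofNat 6 n))).headD 0 = n := by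
      simp only [rowOf, List.ofFn_succ, List.headD_cons]
      rw [hc0, hof n hn6]
    rw [hh, Nat.beq_refl] at h
    refine ih (n + 1) _ _ (by omega) ?_ ?_ h
    · intro i hi
      rw [List.mem_filter]
      refine ⟨hc i (by omega), rowDisj_rowOf _ _ ?_⟩
      intro j
      apply hfr
      intro e
      have := congrArg Fin.val e
      rw [hof n hn6] at this
      omega
    · rw [List.forall₂_map_right_iff]
      refine hF.imp ?_
      intro k L hk
      refine mem_extAll _ _ _ _ hk (mem_rowItems _ _ _) ?_
      have key : ∀ a ≤ n, Nat.land (partCode f t k a)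
          (cellCode n (t k (Fin.ofNat 6 n)).val (f (Fin.ofNat 6 n) (t k (Fin.ofNat 6 n))).val)
            = 0 := by
        intro a
        induction a with
        | zero => intro _; exact Nat.zero_and _
        | succ a iha =>
          intro ha
          have hd := hne a n (by omega) hn6 (by omega)
          apply lor_land
          · exact iha (by omega)
          · apply cellCode_disj _ _ _ _ _ _ (Fin.isLt _) (Fin.isLt _) (Fin.isLt _) (Fin.isLt _)
            · exact fun e => ht k _ _ hd (Fin.ext e)
            · exact fun e => hft k _ _ hd (Fin.ext e)
      exact key n le_rfl

theorem normalized_absurd (f g : Fin 6 → Fin 6 → Fin 6)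
    (hfr : ∀ i, Function.Injective (f i)) (hfc : ∀ j, Function.Injective fun i => f i j)
    (hgr : ∀ i, Function.Injective (g i)) (hgc : ∀ j, Function.Injective fun i => g i j)
    (ho : ∀ i j i' j', f i j = f i' j' → g i j = g i' j' → i = i' ∧ j = j')
    (h0 : ∀ j, f 0 j = j) (hc0 : ∀ i, f i 0 = i) (hg0 : ∀ j, g 0 j = j)
    (hchk : checkRow (rowOf (f 1)) = true) : False := by
  have hs : ∀ k i, ∃ j, g i j = k := fun k i => Finite.surjective_of_injective (hgr i) k
  choose t ht using hs
  have ht0 : ∀ k, t k 0 = k := fun k => by rw [← hg0 (t k 0), ht]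
  have hfr' : ∀ i i' j, i ≠ i' → f i j ≠ f i' j := fun i i' j h e => h (hfc j e)
  have htt : ∀ k i i', i ≠ i' → t k i ≠ t k i' := by
    intro k i i' h e
    apply h
    apply hgc (t k i)
    change g i (t k i) = g i' (t k i)
    rw [ht, e, ht]
  have hft : ∀ k i i', i ≠ i' → f i (t k i) ≠ f i' (t k i') := by
    intro k i i' h e
    exact h (ho _ _ _ _ e (by rw [ht, ht])).1
  have htk : ∀ k k' i, k ≠ k' → t k i ≠ t k' i := by
    intro k k' i h e
    apply h
    rw [← ht k i, e, ht]
  have hrz : rowOf (f 0) = rowZero := by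
    simp [rowOf, rowZero, List.ofFn_succ, h0]
  unfold checkRow at hchk
  have hp1 : List.Forall₂ (fun k L => partCode f t k 1 ∈ L) (List.finRange 6) startParts := by
    have e : ∀ k, partCode f t k 1 = cellCode 0 k.val k.val := by
      intro k
      have : Fin.ofNat 6 0 = (0 : Fin 6) := rfl
      simp only [partCode]
      rw [this, ht0, h0]
      exact Nat.zero_or _
    simp only [e]
    simp [startParts, rowItems, rowZero, List.finRange_succ]
  have hp2 : List.Forall₂ (fun k L => partCode f t k 2 ∈ L) (List.finRange 6)
      (startParts.map (extAll (rowItems 1 (rowOf (f 1))))) := by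
    rw [List.forall₂_map_right_iff]
    refine hp1.imp ?_
    intro k L hk
    refine mem_extAll _ _ _ _ hk (mem_rowItems _ _ _) ?_
    apply lor_land
    · exact Nat.zero_and _
    · apply cellCode_disj _ _ _ _ _ _ (Fin.isLt _) (Fin.isLt _) (Fin.isLt _) (Fin.isLt _)
      · exact fun e => htt k _ _ (by decide) (Fin.ext e)
      · exact fun e => hft k _ _ (by decide) (Fin.ext e)
  refine search_sound f t hfr' hc0 htt hft htk 4 2 _ _ rfl ?_ hp2 hchk
  intro i hi
  rw [List.mem_filter, List.mem_filter, ← hrz]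
  refine ⟨⟨mem_allRows _ (hfr i), rowDisj_rowOf _ _ fun j => hfr' _ _ j ?_⟩,
    rowDisj_rowOf _ _ fun j => hfr' _ _ j ?_⟩
  · rintro rfl; simp at hi
  · rintro rfl; simp at hi

theorem conj_of_conjRow (σ : Fin 6 → Fin 6) (c u : List ℕ) (hc : c ∈ canonRows)
    (h : conjRow (rowOf σ) c u = true) :
    ∃ c ∈ canonRows, ∃ τ : Fin 6 → Fin 6, Function.Injective τ ∧
      ∀ j, σ (τ j) = τ (canonFun c j) := by
  unfold conjRow at h
  simp only [List.all_eq_true, Bool.and_eq_true, Nat.ble_eq,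
    Bool.or_eq_true, Bool.not_eq_true'] at h
  have hz : ∀ j : Fin 6, j.val ∈ rowZero := by decide
  have hlt : ∀ j : Fin 6, u.getD j.val 0 < 6 := fun j => by
    have := (h _ (hz j)).2.1
    omega
  refine ⟨c, hc, fun j => ⟨u.getD j.val 0, hlt j⟩, ?_, ?_⟩
  · intro j k e
    have e := congrArg Fin.val e
    rcases (h _ (hz j)).2.2 _ (hz k) with h' | h'
    · exact Fin.ext (Nat.eq_of_beq_eq_true h')
    · have e' : u.getD j.val 0 = u.getD k.val 0 := e
      rw [e', Nat.beq_refl] at h'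
      exact absurd h' (by decide)
  · intro j
    have h1 := Nat.eq_of_beq_eq_true (h _ (hz j)).1
    rw [getD_rowOf σ _ (hlt j)] at h1
    have hcj : c.getD j.val 0 < 6 := canonRows_lt c hc j
    apply Fin.ext
    refine h1.trans ?_
    simp only [canonFun]
    have : (Fin.ofNat 6 (c.getD j.val 0)).val = c.getD j.val 0 := Nat.mod_eq_of_lt hcj
    rw [this]

theorem conj_check : conjCheck = true := by decide +kernel

theorem conj_exists (σ : Fin 6 → Fin 6) (hσ : Function.Injective σ) (hd : ∀ j, σ j ≠ j) :
    ∃ c ∈ canonRows, ∃ τ : Fin 6 → Fin 6, Function.Injective τ ∧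
      ∀ j, σ (τ j) = τ (canonFun c j) := by
  have h := conj_check
  unfold conjCheck at h
  rw [List.all_eq_true] at h
  have hrz : rowZero = rowOf id := by decide
  have h := h (rowOf σ) (by
    rw [List.mem_filter, hrz]
    exact ⟨mem_allRows σ hσ, rowDisj_rowOf _ _ fun j => (hd j).symm⟩)
  unfold conjTest at h
  simp only [Bool.or_eq_true, List.any_eq_true] at h
  rcases h with ((h | ⟨_, _, _, _, h⟩) | ⟨_, _, h⟩) | ⟨_, _, _, _, h⟩
  · exact conj_of_conjRow σ _ _ (by decide) h
  · exact conj_of_conjRow σ _ _ (by decide) h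
  · exact conj_of_conjRow σ _ _ (by decide) h
  · exact conj_of_conjRow σ _ _ (by decide) h

theorem check_six : checkRow [1, 2, 3, 4, 5, 0] = true := by decide +kernel
theorem check_four_two : checkRow [1, 2, 3, 0, 5, 4] = true := by decide +kernel
theorem check_three_three : checkRow [1, 2, 0, 4, 5, 3] = true := by decide +kernel
theorem check_two_two_two : checkRow [1, 0, 3, 2, 5, 4] = true := by decide +kernel

theorem check_canon (c : List ℕ) (hc : c ∈ canonRows) : checkRow (rowOf (canonFun c)) = true := by
  have h : ∀ c ∈ canonRows, rowOf (canonFun c) = c := by decide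
  rw [h c hc]
  simp only [canonRows, List.mem_cons, List.not_mem_nil, or_false] at hc
  rcases hc with rfl | rfl | rfl | rfl
  · exact check_six
  · exact check_four_two
  · exact check_three_three
  · exact check_two_two_two

/-- **Euler's 36 officers problem.** There is no Graeco-Latin square of order 6:
there are no two orthogonal Latin squares of order 6. -/
theorem no_graeco_latin_square_order_6 :
    ¬ ∃ f g : Fin 6 × Fin 6 → Fin 6,
      (∀ i : Fin 6, Function.Bijective fun j => f (i, j)) ∧
      (∀ j : Fin 6, Function.Bijective fun i => f (i, j)) ∧
      (∀ i : Fin 6, Function.Bijective fun j => g (i, j)) ∧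
      (∀ j : Fin 6, Function.Bijective fun i => g (i, j)) ∧
      Function.Bijective (fun x : Fin 6 × Fin 6 => (f x, g x)) := by
  rintro ⟨f, g, hfr, hfc, hgr, hgc, ho⟩
  have ho' : ∀ i j i' j', f (i, j) = f (i', j') → g (i, j) = g (i', j') → i = i' ∧ j = j' := by
    intro i j i' j' h1 h2
    have := @ho.1 (i, j) (i', j') (Prod.ext h1 h2)
    exact Prod.mk.inj this
  let r : Fin 6 ≃ Fin 6 := Equiv.ofBijective _ (hfr 0)
  have hr : ∀ j, r j = f (0, j) := fun _ => rfl
  obtain ⟨c, hc, τ', hτ', hστ⟩ := conj_exists (fun j => r.symm (f (1, j)))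
    (r.symm.injective.comp (hfr 1).1) (by
      intro j e
      have e : f (1, j) = r j := (Equiv.symm_apply_eq r).1 e
      exact absurd ((hfc j).1 e) (by decide))
  let τ : Fin 6 ≃ Fin 6 := Equiv.ofBijective τ' (Finite.injective_iff_bijective.1 hτ')
  have hτ : ∀ j, τ j = τ' j := fun _ => rfl
  let e1 : Fin 6 ≃ Fin 6 := r.symm.trans τ.symm
  let π : Fin 6 ≃ Fin 6 := (Equiv.ofBijective _ (hfc (τ 0))).trans e1
  have hπ : ∀ i, π i = e1 (f (i, τ 0)) := fun _ => rfl
  have hF0 : ∀ j, e1 (f (0, τ j)) = j := by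
    intro j
    change τ.symm (r.symm (r (τ j))) = j
    simp
  have hF1 : ∀ j, e1 (f (1, τ j)) = canonFun c j := by
    intro j
    change τ.symm (r.symm (f (1, τ j))) = _
    rw [Equiv.symm_apply_eq]
    exact hστ j
  have hπ0 : π.symm 0 = 0 := by
    rw [Equiv.symm_apply_eq, hπ, hF0]
  have hπ1 : π.symm 1 = 1 := by
    rw [Equiv.symm_apply_eq, hπ, hF1, canonRows_head c hc]
  let ρ : Fin 6 ≃ Fin 6 := τ.trans (Equiv.ofBijective _ (hgr 0))
  have hρ : ∀ j, ρ j = g (0, τ j) := fun _ => rfl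
  refine normalized_absurd (fun i j => e1 (f (π.symm i, τ j)))
    (fun i j => ρ.symm (g (π.symm i, τ j))) ?_ ?_ ?_ ?_ ?_ ?_ ?_ ?_ ?_
  · intro i j j' h
    exact τ.injective ((hfr _).1 (e1.injective h))
  · intro j i i' h
    exact π.symm.injective ((hfc _).1 (e1.injective h))
  · intro i j j' h
    exact τ.injective ((hgr _).1 (ρ.symm.injective h))
  · intro j i i' h
    exact π.symm.injective ((hgc _).1 (ρ.symm.injective h))
  · intro i j i' j' h1 h2
    have := ho' _ _ _ _ (e1.injective h1) (ρ.symm.injective h2)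
    exact ⟨π.symm.injective this.1, τ.injective this.2⟩
  · intro j
    simp only [hπ0, hF0]
  · intro i
    change e1 (f (π.symm i, τ 0)) = i
    rw [← hπ, Equiv.apply_symm_apply]
  · intro j
    simp only [hπ0]
    rw [Equiv.symm_apply_eq, hρ]
  · have : (fun j => e1 (f (π.symm 1, τ j))) = canonFun c := by
      funext j
      rw [hπ1, hF1]
    rw [this]
    exact check_canon c hc
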